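/- Fix 1 ≤ l ≤ D, a string s_{l−1} over 𝒜 of length l−1, and a one-symbol extension s_l = q₀s_{l−1} for some q₀ ∈ 𝒜. For every T′ ∈ 𝒯(D) with s_l ∈ ℒ(T′), the pruned tree Prune(T′), whose leaf set is (ℒ(T′) ∖ {t ∈ ℒ(T′) : s_{l−1} is a suffix of t}) ∪ {s_{l−1}}, belongs to 𝒯(D) and has s_{l−1} as a leaf. Moreover, for each T ∈ 𝒯(D) with s_{l−1} ∈ ℒ(T), the fiber Prune^{−1}(T) equals 𝒯_{s_l;T} := {T′ ∈ 𝒯(D) : s_l ∈ ℒ(T′) and ℒ(T) ⊆ ℒ(T′) ∪ {s_{l−1}}}, and the nonempty sets 𝒯_{s_l;T}, indexed by T with s_{l−1} ∈ ℒ(T), are pairwise disjoint with union {T′ ∈ 𝒯(D) : s_l ∈ ℒ(T′)}. -/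

import Mathlib

open scoped Classical

noncomputable section

variable {𝒜 : Type*}

/-- The finset of all strings over `𝒜` of length at most `D`. -/
def stringsLe (𝒜 : Type*) [Fintype 𝒜] (D : ℕ) : Finset (List 𝒜) :=
  Set.Finite.toFinset (List.finite_length_le 𝒜 D)

/-- A context tree of maximum depth `D`, identified with its leaf set: every leaf has length
at most `D`, no leaf is a (proper) suffix of another, and every string of length `D` has
exactly one suffix among the leaves. -/
def IsContextTree (D : ℕ) (T : Finset (List 𝒜)) : Prop :=
  (∀ s ∈ T, s.length ≤ D) ∧
  (∀ s ∈ T, ∀ t ∈ T, s <:+ t → s = t) ∧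
  (∀ w : List 𝒜, w.length = D → ∃! s, s ∈ T ∧ s <:+ w)

/-- The finset of all context trees of maximum depth `D`. -/
def contextTrees (𝒜 : Type*) [Fintype 𝒜] (D : ℕ) : Finset (Finset (List 𝒜)) :=
  (stringsLe 𝒜 D).powerset.filter (IsContextTree D)

/-- The branching-process prior `π_D` on context trees. -/
def priorD [Fintype 𝒜] (lam : ℝ) (D : ℕ) (T : Finset (List 𝒜)) : ℝ :=
  (1 - lam) ^ ((T.card - 1) / (Fintype.card 𝒜 - 1)) *
    lam ^ (T.card - (T.filter (fun s => s.length = D)).card)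

/-- The window `(x_{1-D}, …, x_{j-1})`. -/
def window (x : ℤ → 𝒜) (D : ℕ) (j : ℕ) : List 𝒜 :=
  (List.range (D + j - 1)).map (fun i => x (1 - (D : ℤ) + (i : ℤ)))

/-- The counting vector `𝐧_{n,s}(a)`. -/
def cnt [DecidableEq 𝒜] (x : ℤ → 𝒜) (D n : ℕ) (s : List 𝒜) (a : 𝒜) : ℕ :=
  ((Finset.Icc 1 n).filter (fun (j : ℕ) => x (j : ℤ) = a ∧ s <:+ window x D j)).card

/-- The evidence value `P^e(m)` of a counting vector `m` under Dirichlet parameters `α`. -/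
def pEv [Fintype 𝒜] (α : 𝒜 → ℝ) (m : 𝒜 → ℕ) : ℝ :=
  (Real.Gamma (∑ a, α a) / Real.Gamma (∑ a, ((m a : ℝ) + α a))) *
    ∏ a, (Real.Gamma ((m a : ℝ) + α a) / Real.Gamma (α a))

/-- The evidence `p^e_{n,s}`. -/
def pE [Fintype 𝒜] [DecidableEq 𝒜] (α : 𝒜 → ℝ) (x : ℤ → 𝒜) (D n : ℕ) (s : List 𝒜) : ℝ :=
  pEv α (cnt x D n s)

/-- Auxiliary downward recursion for the CTW weighted probabilities, with fuel `k = D - |s|`. -/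
def pWaux [Fintype 𝒜] [DecidableEq 𝒜] (α : 𝒜 → ℝ) (lam : ℝ) (x : ℤ → 𝒜) (D n : ℕ) :
    ℕ → List 𝒜 → ℝ
  | 0, s => pE α x D n s
  | k + 1, s => lam * pE α x D n s + (1 - lam) * ∏ q, pWaux α lam x D n k (q :: s)

/-- The CTW weighted probability `p^w_{n,s}`. -/
def pW [Fintype 𝒜] [DecidableEq 𝒜] (α : 𝒜 → ℝ) (lam : ℝ) (x : ℤ → 𝒜) (D n : ℕ)
    (s : List 𝒜) : ℝ :=
  pWaux α lam x D n (D - s.length) s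

/-- The observed suffix `s_{n,l} = (x_{n-l+1}, …, x_n)` of length `l`. -/
def sfx (x : ℤ → 𝒜) (n : ℤ) (l : ℕ) : List 𝒜 :=
  (List.range l).map (fun i => x (n - (l : ℤ) + 1 + (i : ℤ)))

/-- The CTW mixture weight `ω_{n,l}`. -/
def omegaW [Fintype 𝒜] [DecidableEq 𝒜] (α : 𝒜 → ℝ) (lam : ℝ) (x : ℤ → 𝒜) (D n l : ℕ) : ℝ :=
  (∑ T ∈ (contextTrees 𝒜 D).filter (fun T => sfx x n l ∈ T),
      priorD lam D T * ∏ s ∈ T, pE α x D n s) / pW α lam x D n []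

/-- The per-suffix Bayesian predictor `p̄_{n,s}(a)`. -/
def pBar [Fintype 𝒜] [DecidableEq 𝒜] (α : 𝒜 → ℝ) (x : ℤ → 𝒜) (D n : ℕ) (s : List 𝒜)
    (a : 𝒜) : ℝ :=
  (α a + cnt x D n s a) / ∑ q, (α q + cnt x D n s q)

end

/-- Pruning at the string `s`: remove all leaves having `s` as a suffix and insert `s`. -/
noncomputable def prune {𝒜 : Type*} [DecidableEq 𝒜] (s : List 𝒜) (T : Finset (List 𝒜)) :
    Finset (List 𝒜) :=
  T.filter (fun t => ¬ s <:+ t) ∪ {s}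

theorem mem_contextTrees {𝒜 : Type*} [Fintype 𝒜] {D : ℕ} {T : Finset (List 𝒜)} :
    T ∈ contextTrees 𝒜 D ↔ IsContextTree D T := by
  simp only [contextTrees, Finset.mem_filter, Finset.mem_powerset, and_iff_right_iff_imp]
  intro h t ht
  simpa [stringsLe] using h.1 t ht

theorem mem_prune {𝒜 : Type*} [DecidableEq 𝒜] {s t : List 𝒜} {T : Finset (List 𝒜)} :
    t ∈ prune s T ↔ (t ∈ T ∧ ¬ s <:+ t) ∨ t = s := by
  simp [prune, or_comm]

namespace IsContextTree

variable {𝒜 : Type*} {D : ℕ} {T U : Finset (List 𝒜)} {s : List 𝒜} {q : 𝒜}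

/-- A context tree contained in another one is equal to it. -/
theorem eq_of_subset [Nonempty 𝒜] (hT : IsContextTree D T) (hU : IsContextTree D U)
    (h : T ⊆ U) : T = U := by
  refine h.antisymm fun u hu => ?_
  obtain ⟨q⟩ := ‹Nonempty 𝒜›
  have hw : (List.replicate (D - u.length) q ++ u).length = D := by
    have := hU.1 u hu
    simp only [List.length_append, List.length_replicate]
    omega
  obtain ⟨t, ⟨htT, htw⟩, -⟩ := hT.2.2 _ hw
  have htu : t = u := (hU.2.2 _ hw).unique ⟨h htT, htw⟩ ⟨hu, List.suffix_append _ _⟩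
  exact htu ▸ htT

/-- No leaf of a context tree is a suffix of the parent of a leaf. -/
theorem not_suffix_of_cons_mem (hT : IsContextTree D T) (hq : q :: s ∈ T) {t : List 𝒜}
    (ht : t ∈ T) : ¬ t <:+ s := by
  intro hts
  have h := hT.2.1 t ht _ hq (hts.trans (List.suffix_cons q s))
  have := hts.length_le
  simp [h] at this

theorem prune [DecidableEq 𝒜] (hT : IsContextTree D T) (hq : q :: s ∈ T) :
    IsContextTree D (prune s T) := by
  refine ⟨fun t ht => ?_, fun a ha b hb hab => ?_, fun w hw => ?_⟩
  · rcases mem_prune.1 ht with ht | rfl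
    · exact hT.1 t ht.1
    · have := hT.1 _ hq
      simp only [List.length_cons] at this
      omega
  · rcases mem_prune.1 ha with ha | rfl <;> rcases mem_prune.1 hb with hb | rfl
    · exact hT.2.1 a ha.1 b hb.1 hab
    · exact absurd hab (hT.not_suffix_of_cons_mem hq ha.1)
    · exact absurd hab hb.2
    · rfl
  · by_cases hsw : s <:+ w
    · refine ⟨s, ⟨mem_prune.2 (Or.inr rfl), hsw⟩, fun t ht => ?_⟩
      rcases mem_prune.1 ht.1 with h | h
      · rcases List.suffix_or_suffix_of_suffix ht.2 hsw with h' | h'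
        · exact absurd h' (hT.not_suffix_of_cons_mem hq h.1)
        · exact absurd h' h.2
      · exact h
    · obtain ⟨t, ⟨htT, htw⟩, hu⟩ := hT.2.2 w hw
      refine ⟨t, ⟨mem_prune.2 (Or.inl ⟨htT, fun h => hsw (h.trans htw)⟩), htw⟩,
        fun u hu' => ?_⟩
      rcases mem_prune.1 hu'.1 with h | rfl
      · exact hu u ⟨h.1, hu'.2⟩
      · exact absurd hu'.2 hsw

/-- Over a tree with leaf `s`, the fiber of pruning at `s` is described by leaf inclusion. -/
theorem prune_eq_iff [DecidableEq 𝒜] (hU : IsContextTree D U) (hq : q :: s ∈ U)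
    (hT : IsContextTree D T) (hs : s ∈ T) : _root_.prune s U = T ↔ T ⊆ U ∪ {s} := by
  constructor
  · rintro rfl t ht
    rcases mem_prune.1 ht with h | h
    · simp [h.1]
    · simp [h]
  · intro h
    have : Nonempty 𝒜 := ⟨q⟩
    refine (hT.eq_of_subset (hU.prune hq) fun t ht => mem_prune.2 ?_).symm
    by_cases hts : t = s
    · exact Or.inr hts
    · have := h ht
      simp only [Finset.mem_union, Finset.mem_singleton, hts, or_false] at this
      exact Or.inl ⟨this, fun hst => hts (hT.2.1 s hs t ht hst).symm⟩

/-- Replacing a leaf of length less than `D` by all its one-symbol extensions yields a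
context tree. -/
theorem split [Fintype 𝒜] [DecidableEq 𝒜] (hT : IsContextTree D T) (hs : s ∈ T)
    (hD : s.length < D) :
    IsContextTree D (T.erase s ∪ Finset.univ.image (fun q : 𝒜 => q :: s)) := by
  have hmem : ∀ t, t ∈ T.erase s ∪ Finset.univ.image (fun q : 𝒜 => q :: s) ↔
      (t ≠ s ∧ t ∈ T) ∨ ∃ q, q :: s = t := by simp
  refine ⟨fun t ht => ?_, fun a ha b hb hab => ?_, fun w hw => ?_⟩
  · rcases (hmem t).1 ht with h | ⟨q, rfl⟩
    · exact hT.1 t h.2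
    · simpa using hD
  · rcases (hmem a).1 ha with ha | ⟨q, rfl⟩ <;> rcases (hmem b).1 hb with hb | ⟨r, rfl⟩
    · exact hT.2.1 a ha.2 b hb.2 hab
    · rcases List.suffix_cons_iff.1 hab with h | h
      · exact h
      · exact absurd (hT.2.1 a ha.2 s hs h) ha.1
    · exact absurd (hT.2.1 s hs b hb.2 ((List.suffix_cons q s).trans hab)).symm hb.1
    · exact hab.eq_of_length (by simp)
  · obtain ⟨t, ⟨htT, htw⟩, hu⟩ := hT.2.2 w hw
    by_cases hts : t = s
    · subst hts
      obtain ⟨p, rfl⟩ := htw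
      rcases List.eq_nil_or_concat p with rfl | ⟨p, q, rfl⟩
      · simp at hw
        omega
      · have hqw : q :: t <:+ (p ++ [q]) ++ t := ⟨p, by simp⟩
        refine ⟨q :: t, ⟨(hmem _).2 (Or.inr ⟨q, rfl⟩), by simp⟩, fun u hu' => ?_⟩
        rcases (hmem u).1 hu'.1 with h | ⟨r, rfl⟩
        · exact absurd (hu u ⟨h.2, hu'.2⟩) h.1
        · have hrw : r :: t <:+ (p ++ [q]) ++ t := by simpa using hu'.2
          exact (List.suffix_of_suffix_length_le hrw hqw (by simp)).eq_of_length (by simp)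
    · refine ⟨t, ⟨(hmem t).2 (Or.inl ⟨hts, htT⟩), htw⟩, fun u hu' => ?_⟩
      rcases (hmem u).1 hu'.1 with h | ⟨r, rfl⟩
      · exact hu u ⟨h.2, hu'.2⟩
      · exact absurd (hu s ⟨hs, (List.suffix_cons r s).trans hu'.2⟩).symm hts

end IsContextTree

/-- Pruning a context tree containing the leaf `s_l = q₀ :: s_{l-1}` at
`s_{l-1}` yields a context tree with leaf `s_{l-1}`; for each tree `T` with leaf `s_{l-1}`, the
fiber of the pruning map over `T` is exactly `𝒯_{s_l;T}`, and these nonempty fibers are pairwise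
disjoint with union `{T' ∈ 𝒯(D) : s_l ∈ ℒ(T')}`. -/
theorem prune_fiber_partition {𝒜 : Type*} [Fintype 𝒜] [DecidableEq 𝒜]
    (hA : 2 ≤ Fintype.card 𝒜) (D l : ℕ) (hD : 1 ≤ D) (hl : 1 ≤ l) (hlD : l ≤ D)
    (s : List 𝒜) (hs : s.length = l - 1) (q₀ : 𝒜) :
    (∀ T' ∈ contextTrees 𝒜 D, q₀ :: s ∈ T' →
        prune s T' ∈ contextTrees 𝒜 D ∧ s ∈ prune s T') ∧
    (∀ T ∈ contextTrees 𝒜 D, s ∈ T →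
        (contextTrees 𝒜 D).filter (fun T' => q₀ :: s ∈ T' ∧ prune s T' = T)
          = (contextTrees 𝒜 D).filter (fun T' => q₀ :: s ∈ T' ∧ T ⊆ T' ∪ {s})) ∧
    (∀ T ∈ contextTrees 𝒜 D, s ∈ T →
        ((contextTrees 𝒜 D).filter (fun T' => q₀ :: s ∈ T' ∧ T ⊆ T' ∪ {s})).Nonempty) ∧
    (∀ T₁ ∈ contextTrees 𝒜 D, ∀ T₂ ∈ contextTrees 𝒜 D, s ∈ T₁ → s ∈ T₂ → T₁ ≠ T₂ →
        Disjoint ((contextTrees 𝒜 D).filter (fun T' => q₀ :: s ∈ T' ∧ T₁ ⊆ T' ∪ {s}))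
          ((contextTrees 𝒜 D).filter (fun T' => q₀ :: s ∈ T' ∧ T₂ ⊆ T' ∪ {s}))) ∧
    ((contextTrees 𝒜 D).filter (fun T => s ∈ T)).biUnion
        (fun T => (contextTrees 𝒜 D).filter (fun T' => q₀ :: s ∈ T' ∧ T ⊆ T' ∪ {s}))
      = (contextTrees 𝒜 D).filter (fun T' => q₀ :: s ∈ T') := by
  have hsD : s.length < D := by omega
  refine ⟨fun T' hT' hq => ?_, fun T hT hsT => ?_, fun T hT hsT => ?_,
    fun T₁ hT₁ T₂ hT₂ hs₁ hs₂ hne => ?_, ?_⟩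
  · exact ⟨mem_contextTrees.2 ((mem_contextTrees.1 hT').prune hq), mem_prune.2 (Or.inr rfl)⟩
  · refine Finset.filter_congr fun T' hT' => and_congr_right fun hq => ?_
    exact (mem_contextTrees.1 hT').prune_eq_iff hq (mem_contextTrees.1 hT) hsT
  · refine ⟨T.erase s ∪ Finset.univ.image (fun q : 𝒜 => q :: s), Finset.mem_filter.2
      ⟨mem_contextTrees.2 ((mem_contextTrees.1 hT).split hsT hsD), by simp, fun t ht => ?_⟩⟩
    by_cases h : t = s <;> simp [h, ht]
  · refine Finset.disjoint_left.2 fun T' h₁ h₂ => hne ?_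
    obtain ⟨hT', hq, h₁⟩ := Finset.mem_filter.1 h₁
    obtain ⟨-, -, h₂⟩ := Finset.mem_filter.1 h₂
    rw [mem_contextTrees] at hT' hT₁ hT₂
    rw [← (hT'.prune_eq_iff hq hT₁ hs₁).2 h₁, (hT'.prune_eq_iff hq hT₂ hs₂).2 h₂]
  · ext T'
    simp only [Finset.mem_biUnion, Finset.mem_filter]
    constructor
    · rintro ⟨T, -, hT', hq, -⟩
      exact ⟨hT', hq⟩
    · rintro ⟨hT', hq⟩
      have hU := mem_contextTrees.1 hT'
      have hs' : s ∈ prune s T' := mem_prune.2 (Or.inr rfl)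
      exact ⟨prune s T', ⟨mem_contextTrees.2 (hU.prune hq), hs'⟩, hT', hq,
        (hU.prune_eq_iff hq (hU.prune hq) hs').1 rfl⟩
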